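/- Let n ≥ 2, γ > 0, and set β = γ·ln(n). Let X be an n×n real matrix and suppose P is an n×n doubly stochastic matrix maximizing ⟨P, X⟩ + (1/β)·H(P) over all n×n doubly stochastic matrices. Then for every n×n doubly stochastic matrix Q, the average assignment error satisfies (1/n)·(⟨Q, X⟩ - ⟨P, X⟩) ≤ 1/γ. -/

import Mathlib

/-- `P` is doubly stochastic: nonnegative entries, rows and columns sum to 1. -/
def IsDoublyStochasticMat {n : ℕ} (P : Matrix (Fin n) (Fin n) ℝ) : Prop :=
  (∀ i j, 0 ≤ P i j) ∧ (∀ i, ∑ j, P i j = 1) ∧ (∀ j, ∑ i, P i j = 1)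

/-- Frobenius inner product `⟨P, X⟩ = ∑_{i,j} P_{ij} X_{ij}`. -/
def frobInner {n : ℕ} (P X : Matrix (Fin n) (Fin n) ℝ) : ℝ :=
  ∑ i, ∑ j, P i j * X i j

/-- Entropy `H(P) = -∑_{i,j} P_{ij} ln P_{ij}` (with `0 * ln 0 = 0`). -/
noncomputable def matEntropy {n : ℕ} (P : Matrix (Fin n) (Fin n) ℝ) : ℝ :=
  -∑ i, ∑ j, P i j * Real.log (P i j)

/-- The entropy of a doubly stochastic matrix is nonnegative. -/
theorem IsDoublyStochasticMat.matEntropy_nonneg {n : ℕ} {P : Matrix (Fin n) (Fin n) ℝ}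
    (hP : IsDoublyStochasticMat P) : 0 ≤ matEntropy P := by
  obtain ⟨h0, hrow, -⟩ := hP
  refine neg_nonneg.2 (Finset.sum_nonpos fun i _ => Finset.sum_nonpos fun j _ => ?_)
  have h1 : P i j ≤ 1 :=
    hrow i ▸ Finset.single_le_sum (fun k _ => h0 i k) (Finset.mem_univ j)
  exact Real.mul_log_nonpos (h0 i j) h1

/-- Tangent-line bound for `-p log p` at `p = 1 / a`. -/
theorem neg_mul_log_le_mul_log_add {p a : ℝ} (hp : 0 ≤ p) (ha : 0 < a) :
    -(p * Real.log p) ≤ p * Real.log a + (1 / a - p) := by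
  rcases hp.eq_or_lt with rfl | hp
  · simpa using ha.le
  · have h := mul_le_mul_of_nonneg_left
      (Real.log_le_sub_one_of_pos (inv_pos.2 (mul_pos ha hp))) hp.le
    rw [Real.log_inv, Real.log_mul ha.ne' hp.ne'] at h
    have e : p * ((a * p)⁻¹ - 1) = 1 / a - p := by field_simp
    linarith

/-- The entropy of an `n × n` doubly stochastic matrix is at most `n log n`. -/
theorem IsDoublyStochasticMat.matEntropy_le {n : ℕ} {P : Matrix (Fin n) (Fin n) ℝ}
    (hP : IsDoublyStochasticMat P) : matEntropy P ≤ n * Real.log n := by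
  obtain ⟨h0, hrow, -⟩ := hP
  have key : ∀ i, ∑ j, -(P i j * Real.log (P i j)) ≤ Real.log n := by
    intro i
    have hn : (0 : ℝ) < n := Nat.cast_pos.2 i.pos
    calc ∑ j, -(P i j * Real.log (P i j))
        ≤ ∑ j, (P i j * Real.log n + (1 / (n : ℝ) - P i j)) :=
          Finset.sum_le_sum fun j _ => neg_mul_log_le_mul_log_add (h0 i j) hn
      _ = Real.log n := by
          rw [Finset.sum_add_distrib, ← Finset.sum_mul, Finset.sum_sub_distrib, hrow i]
          simp [hn.ne']
  calc matEntropy P = ∑ i, ∑ j, -(P i j * Real.log (P i j)) := by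
        simp [matEntropy, Finset.sum_neg_distrib]
    _ ≤ ∑ _i : Fin n, Real.log n := Finset.sum_le_sum fun i _ => key i
    _ = n * Real.log n := by simp

/-- With `β = γ ln n`, the average assignment error of the entropic maximizer is at
most `1/γ`. -/
theorem average_assignment_error_bound (n : ℕ) (hn : 2 ≤ n) (γ : ℝ) (hγ : 0 < γ)
    (β : ℝ) (hβ : β = γ * Real.log n)
    (X P : Matrix (Fin n) (Fin n) ℝ)
    (hP : IsDoublyStochasticMat P)
    (hmax : ∀ Q : Matrix (Fin n) (Fin n) ℝ, IsDoublyStochasticMat Q →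
      frobInner Q X + (1 / β) * matEntropy Q ≤ frobInner P X + (1 / β) * matEntropy P) :
    ∀ Q : Matrix (Fin n) (Fin n) ℝ, IsDoublyStochasticMat Q →
      (1 / n) * (frobInner Q X - frobInner P X) ≤ 1 / γ := by
  intro Q hQ
  have hn0 : (0 : ℝ) < n := by exact_mod_cast (by omega : 0 < n)
  have hlog : 0 < Real.log n := Real.log_pos (by exact_mod_cast (by omega : 1 < n))
  have hβ0 : 0 < 1 / β := by rw [hβ]; positivity
  have hQ0 : 0 ≤ 1 / β * matEntropy Q := mul_nonneg hβ0.le hQ.matEntropy_nonneg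
  have hP1 : 1 / β * matEntropy P ≤ 1 / β * (n * Real.log n) :=
    mul_le_mul_of_nonneg_left hP.matEntropy_le hβ0.le
  calc 1 / (n : ℝ) * (frobInner Q X - frobInner P X)
      ≤ 1 / n * (1 / β * (n * Real.log n)) :=
        mul_le_mul_of_nonneg_left (by linarith [hmax Q hQ]) (by positivity)
    _ = 1 / γ := by rw [hβ]; field_simp
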